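/- arXiv:1906.08514 — 3 statements merged into one kernel-verified Lean document; each statement's English description precedes it below -/
import Mathlib

section
/- Let X be a Banach space and let V₁,…,V_k be closed hyperplanes (closed subspaces of codimension 1) of X. Then there exists x ∈ X with ‖x‖ = 1 such that dist(x, V_j) ≥ (1/4)·k^{−5/2} for all j = 1,…,k. -/
/-- Combinatorial selection: at most one bad value on each line in direction `j`
implies that some point is good for all `j`. -/
lemma exists_good_point (n : ℕ) (bad : Fin (n + 1) → (Fin (n + 1) → Fin (n + 2)) → Prop)
    (h : ∀ j a b, bad j a → bad j b → j.removeNth a = j.removeNth b → a j = b j) :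
    ∃ a, ∀ j, ¬ bad j a := by
  by_contra! hc
  choose J hJ using hc
  let F : (Fin (n + 1) → Fin (n + 2)) → Fin (n + 1) × (Fin n → Fin (n + 2)) :=
    fun a => (J a, (J a).removeNth a)
  have hF : Function.Injective F := by
    intro a b hab
    have h1 : J a = J b := congrArg Prod.fst hab
    have h2 : (J a).removeNth a = (J b).removeNth b := congrArg Prod.snd hab
    have hb := hJ b
    rw [← h1] at h2 hb
    have h3 := h _ a b (hJ a) hb h2
    rw [← Fin.insertNth_self_removeNth (J a) a, ← Fin.insertNth_self_removeNth (J a) b, h2, h3]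
  have hcard := Fintype.card_le_of_injective F hF
  simp only [Fintype.card_prod, Fintype.card_fun, Fintype.card_fin] at hcard
  rw [pow_succ] at hcard
  have hp : 0 < (n + 2) ^ n := by positivity
  nlinarith

lemma exists_almost_orthogonal {X : Type*} [NormedAddCommGroup X] [NormedSpace ℝ X]
    (V : Submodule ℝ X) (hc : IsClosed (V : Set X)) (hd : Module.finrank ℝ (X ⧸ V) = 1) :
    ∃ x : X, ‖x‖ = 1 ∧ 1 / 2 ≤ ‖(Submodule.Quotient.mk x : X ⧸ V)‖ := by
  have hne : ∃ x : X, x ∉ V := by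
    by_contra! hcon
    have : V = ⊤ := by ext x; simp [hcon x]
    subst this
    have : Module.finrank ℝ (X ⧸ (⊤ : Submodule ℝ X)) = 0 := Module.finrank_zero_of_subsingleton
    omega
  obtain ⟨x, hx, hr⟩ := riesz_lemma hc hne (r := 1 / 2) (by norm_num)
  have hx0 : x ≠ 0 := fun h => hx (h ▸ V.zero_mem)
  have hn : 0 < ‖x‖ := norm_pos_iff.2 hx0
  have hq : 1 / 2 * ‖x‖ ≤ ‖(Submodule.Quotient.mk x : X ⧸ V)‖ := by
    have : ‖(Submodule.Quotient.mk x : X ⧸ V)‖ = Metric.infDist x (V : Set X) :=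
      QuotientAddGroup.norm_mk (S := V.toAddSubgroup) x
    rw [this, Metric.le_infDist ⟨0, V.zero_mem⟩]
    intro y hy
    rw [dist_eq_norm]
    exact hr y hy
  refine ⟨‖x‖⁻¹ • x, by simp [norm_smul, hn.ne'], ?_⟩
  rw [Submodule.Quotient.mk_smul, norm_smul, norm_inv, norm_norm, inv_mul_eq_div, le_div_iff₀ hn]
  exact hq

/-- Given closed hyperplanes `V₁,…,V_k` of a Banach space `X`, there is a
unit vector `x` with `dist(x, V_j) ≥ (1/4)·k^(−5/2)` for all `j`. -/
theorem stmt2 {X : Type*} [NormedAddCommGroup X] [NormedSpace ℝ X] [CompleteSpace X]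
    (k : ℕ) (hk : 0 < k) (V : Fin k → Submodule ℝ X)
    (hVclosed : ∀ j, IsClosed (V j : Set X))
    (hVcodim : ∀ j, Module.finrank ℝ (X ⧸ V j) = 1) :
    ∃ x : X, ‖x‖ = 1 ∧
      ∀ j, (1 / 4) * (k : ℝ) ^ (-(5 : ℝ) / 2) ≤ Metric.infDist x (V j : Set X) := by
  obtain ⟨n, rfl⟩ : ∃ n, k = n + 1 := ⟨k - 1, by omega⟩
  choose e he1 he2 using fun j => exists_almost_orthogonal (V j) (hVclosed j) (hVcodim j)
  let S : (Fin (n + 1) → Fin (n + 2)) → X := fun a => ∑ i, ((a i : ℕ) : ℝ) • e i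
  obtain ⟨a, ha⟩ := exists_good_point n
    (fun j a => ‖(Submodule.Quotient.mk (S a) : X ⧸ V j)‖ < 1 / 4) (by
      intro j a b hA hB hab
      by_contra hne
      have hS : S a - S b = (((a j : ℕ) : ℝ) - ((b j : ℕ) : ℝ)) • e j := by
        simp only [S]
        rw [Fin.sum_univ_succAbove _ j, Fin.sum_univ_succAbove _ j, sub_smul]
        have : ∀ i, a (j.succAbove i) = b (j.succAbove i) := fun i => congrFun hab i
        simp only [this]
        abel
      have h1 : (1 : ℝ) ≤ |((a j : ℕ) : ℝ) - ((b j : ℕ) : ℝ)| := by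
        have hne' : ((a j : ℕ) : ℤ) - ((b j : ℕ) : ℤ) ≠ 0 := by
          intro h; apply hne; ext; omega
        have := Int.one_le_abs hne'
        exact_mod_cast this
      have h2 : ‖(Submodule.Quotient.mk (S a - S b) : X ⧸ V j)‖ < 1 / 4 + 1 / 4 := by
        rw [Submodule.Quotient.mk_sub]
        exact (norm_sub_le _ _).trans_lt (add_lt_add hA hB)
      rw [hS, Submodule.Quotient.mk_smul, norm_smul, Real.norm_eq_abs] at h2
      have := he2 j
      nlinarith)
  push Not at ha
  have hq : ∀ (j) (x : X), ‖(Submodule.Quotient.mk x : X ⧸ V j)‖ = Metric.infDist x (V j : Set X) :=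
    fun j x => QuotientAddGroup.norm_mk (S := (V j).toAddSubgroup) x
  have hK : (0 : ℝ) < ((n + 1 : ℕ) : ℝ) := by positivity
  have hle : ‖S a‖ ≤ ((n + 1 : ℕ) : ℝ) ^ 2 := by
    calc ‖S a‖ ≤ ∑ i, ‖((a i : ℕ) : ℝ) • e i‖ := norm_sum_le _ _
      _ ≤ ∑ i : Fin (n + 1), ((n + 1 : ℕ) : ℝ) := by
        apply Finset.sum_le_sum
        intro i _
        rw [norm_smul, he1, mul_one, Real.norm_natCast]
        exact_mod_cast (by omega : (a i : ℕ) ≤ n + 1)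
      _ = _ := by simp [sq]; ring
  have hpos : 0 < ‖S a‖ := by
    rw [norm_pos_iff]
    intro h0
    have := ha 0
    rw [h0, Submodule.Quotient.mk_zero, norm_zero] at this
    norm_num at this
  refine ⟨‖S a‖⁻¹ • S a, by simp [norm_smul, hpos.ne'], fun j => ?_⟩
  rw [← hq, Submodule.Quotient.mk_smul, norm_smul, norm_inv, norm_norm]
  have h1 : ((n + 1 : ℕ) : ℝ) ^ (-(5 : ℝ) / 2) ≤ ‖S a‖⁻¹ := by
    calc ((n + 1 : ℕ) : ℝ) ^ (-(5 : ℝ) / 2) ≤ ((n + 1 : ℕ) : ℝ) ^ (-(2 : ℝ)) := by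
          apply Real.rpow_le_rpow_of_exponent_le
          · exact_mod_cast hk
          · norm_num
      _ = (((n + 1 : ℕ) : ℝ) ^ 2)⁻¹ := by
          rw [Real.rpow_neg hK.le]; norm_cast
      _ ≤ ‖S a‖⁻¹ := inv_anti₀ hpos hle
  rw [mul_comm]
  exact mul_le_mul h1 (ha j) (by norm_num) (by positivity)
end

section
/- Let (A_j)_{j∈ℕ} be an arbitrary sequence of matrices in ℝ^{k×k}. For Lebesgue-almost every A ∈ ℝ^{k×k}, there exists ε > 0 such that |det(A + A_j)| ≥ ε·j⁻² for all j ∈ ℕ. -/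
open MeasureTheory

/-- The uniform probability measure on the unit interval. -/
noncomputable def uni : Measure ℝ := volume.restrict (Set.Icc 0 1)

instance uni_prob : IsProbabilityMeasure uni := ⟨by simp [uni]⟩

/-- Resampling one coordinate of a product probability measure. -/
lemma lintegral_resample {ι : Type*} [Fintype ι] [DecidableEq ι] {X : Type*} [MeasurableSpace X]
    (μ : Measure X) [IsProbabilityMeasure μ] (f : (ι → X) → ENNReal) (hf : Measurable f) (i : ι) :
    ∫⁻ x, f x ∂(Measure.pi fun _ : ι => μ)
      = ∫⁻ x, ∫⁻ t, f (Function.update x i t) ∂μ ∂(Measure.pi fun _ : ι => μ) := by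
  classical
  refine lintegral_eq_of_lmarginal_eq (μ := fun _ : ι => μ) {i} hf ?_ ?_
  · refine Measurable.lintegral_prod_right' (f := fun p : (ι → X) × X => f (Function.update p.1 i p.2)) ?_
    refine hf.comp ?_
    refine measurable_pi_lambda _ fun j => ?_
    by_cases h : j = i
    · subst h; simpa using measurable_snd
    · simp only [Function.update_of_ne h]; fun_prop
  · rw [lmarginal_singleton, lmarginal_singleton]
    funext x
    simp

/-- The measure of the unit cube in matrix space. -/
noncomputable def cubeM (k : ℕ) : Measure (Fin k → Fin k → ℝ) :=
  Measure.pi fun _ : Fin k => Measure.pi fun _ : Fin k => uni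

lemma measurable_upd {ι X : Type*} [DecidableEq ι] [MeasurableSpace X] (i : ι) :
    Measurable (fun p : (ι → X) × X => Function.update p.1 i p.2) := by
  refine measurable_pi_lambda _ fun j => ?_
  by_cases h : j = i
  · subst h; simpa using measurable_snd
  · simp only [Function.update_of_ne h]; fun_prop

lemma lintegral_resample2 (k : ℕ) (f : (Fin k → Fin k → ℝ) → ENNReal) (hf : Measurable f)
    (i j : Fin k) :
    ∫⁻ B, f B ∂(cubeM k)
      = ∫⁻ B, ∫⁻ t, f (Function.update B i (Function.update (B i) j t)) ∂uni ∂(cubeM k) := by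
  have hm : Measurable (fun p : (Fin k → Fin k → ℝ) × ℝ =>
      f (Function.update p.1 i (Function.update (p.1 i) j p.2))) := by
    refine hf.comp ?_
    have h1 : Measurable (fun p : (Fin k → Fin k → ℝ) × ℝ => Function.update (p.1 i) j p.2) :=
      (measurable_upd (X := ℝ) j).comp
        (f := fun p : (Fin k → Fin k → ℝ) × ℝ => ((p.1 i, p.2) : (Fin k → ℝ) × ℝ)) (by fun_prop)
    exact (measurable_upd i).comp (measurable_fst.prodMk h1)
  unfold cubeM
  rw [lintegral_resample _ f hf i, lintegral_resample _ _ hm.lintegral_prod_right' i]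
  refine lintegral_congr fun B => ?_
  simp only [Function.update_self, Function.update_idem]
  exact lintegral_resample uni (fun r => f (Function.update B i r))
    (hf.comp ((measurable_upd i).comp (measurable_const.prodMk measurable_id))) j

/-- The one-dimensional constant. -/
noncomputable def KK : ENNReal :=
  1 + ∫⁻ t, (Set.Icc (-1 : ℝ) 1).indicator (fun t => ENNReal.ofReal |t| ^ (-(3/4) : ℝ)) t

lemma KK_ne_zero : KK ≠ 0 := by simp [KK]

lemma KK_ne_top : KK ≠ ⊤ := by
  have h0 : IntervalIntegrable (fun t : ℝ => |t| ^ (-(3/4) : ℝ)) volume (-1) 1 := by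
    have h1 : IntervalIntegrable (fun t : ℝ => |t| ^ (-(3/4) : ℝ)) volume 0 1 := by
      refine (intervalIntegral.intervalIntegrable_rpow' (a := 0) (b := 1)
        (r := (-(3/4) : ℝ)) (by norm_num)).congr ?_
      intro t ht
      rw [Set.uIoc_of_le zero_le_one] at ht
      simp [abs_of_pos ht.1]
    have h2 := h1.comp_sub_left 0
    simp only [zero_sub, abs_neg, neg_zero] at h2
    exact h2.symm.trans h1
  have h1 : IntegrableOn (fun t : ℝ => |t| ^ (-(3/4) : ℝ)) (Set.Icc (-1) 1) volume := by
    rw [integrableOn_Icc_iff_integrableOn_Ioc]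
    exact (intervalIntegrable_iff_integrableOn_Ioc_of_le (by norm_num)).1 h0
  have h2 := h1.lintegral_lt_top
  unfold KK
  rw [lintegral_indicator measurableSet_Icc]
  refine ENNReal.add_ne_top.2 ⟨ENNReal.one_ne_top, ?_⟩
  refine ne_of_lt (lt_of_le_of_lt (le_of_eq ?_) h2)
  refine lintegral_congr_ae ?_
  have : ∀ᵐ t : ℝ ∂(volume.restrict (Set.Icc (-1 : ℝ) 1)), t ≠ 0 :=
    ae_restrict_of_ae (Measure.ae_ne volume 0)
  filter_upwards [this] with t ht
  rw [ENNReal.ofReal_rpow_of_pos (abs_pos.2 ht)]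

lemma one_dim' (c : ℝ) : ∫⁻ t, ENNReal.ofReal |t + c| ^ (-(3/4) : ℝ) ∂uni ≤ KK := by
  set g : ℝ → ENNReal :=
    (Set.Icc (-1 : ℝ) 1).indicator (fun t => ENNReal.ofReal |t| ^ (-(3/4) : ℝ)) with hg
  have h : ∀ u : ℝ, ENNReal.ofReal |u| ^ (-(3/4) : ℝ) ≤ 1 + g u := by
    intro u
    by_cases hu : u ∈ Set.Icc (-1 : ℝ) 1
    · simp [hg, Set.indicator_of_mem hu]
    · have : 1 ≤ |u| := by
        by_contra hh
        push Not at hh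
        exact hu (abs_le.1 hh.le)
      refine le_trans ?_ le_self_add
      rw [ENNReal.rpow_neg, ENNReal.inv_le_one]
      exact ENNReal.one_le_rpow (by simpa using this) (by norm_num)
  calc _ ≤ ∫⁻ t, (1 + g (t + c)) ∂uni := lintegral_mono fun t => h _
    _ = 1 + ∫⁻ t, g (t + c) ∂uni := by
        rw [lintegral_add_left measurable_const]; simp
    _ ≤ 1 + ∫⁻ t, g (t + c) := by
        gcongr; exact Measure.restrict_le_self
    _ = KK := by rw [lintegral_add_right_eq_self g c]; rfl

lemma one_dim (a c : ℝ) : ∫⁻ t, ENNReal.ofReal |t * a + c| ^ (-(3/4) : ℝ) ∂uni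
    ≤ KK * ENNReal.ofReal |a| ^ (-(3/4) : ℝ) := by
  rcases eq_or_ne a 0 with rfl | ha
  · have : ENNReal.ofReal |(0:ℝ)| ^ (-(3/4) : ℝ) = ⊤ := by
      rw [abs_zero, ENNReal.ofReal_zero, ENNReal.zero_rpow_of_neg (by norm_num)]
    rw [this, ENNReal.mul_top KK_ne_zero]
    exact le_top
  · have h : ∀ t : ℝ, ENNReal.ofReal |t * a + c| ^ (-(3/4) : ℝ)
        = ENNReal.ofReal |t + c / a| ^ (-(3/4) : ℝ) * ENNReal.ofReal |a| ^ (-(3/4) : ℝ) := by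
      intro t
      rw [← ENNReal.mul_rpow_of_ne_top ENNReal.ofReal_ne_top ENNReal.ofReal_ne_top,
        ← ENNReal.ofReal_mul (abs_nonneg _), ← abs_mul]
      congr 3
      field_simp
    simp_rw [h]
    rw [lintegral_mul_const]
    · gcongr
      exact one_dim' _
    · fun_prop

lemma det_meas (k m : ℕ) (M : Matrix (Fin k) (Fin k) ℝ) (e : Fin m → Fin k) :
    Measurable (fun B : Fin k → Fin k → ℝ =>
      ENNReal.ofReal |((Matrix.of B + M).submatrix e e).det| ^ (-(3/4) : ℝ)) := by
  have : Measurable (fun B : Fin k → Fin k → ℝ => ((Matrix.of B + M).submatrix e e).det) := by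
    refine Continuous.measurable ?_
    refine Continuous.matrix_det ?_
    refine continuous_matrix fun i j => ?_
    simp only [Matrix.submatrix_apply, Matrix.add_apply, Matrix.of_apply]
    fun_prop
  fun_prop

lemma det_bound (k : ℕ) (M : Matrix (Fin k) (Fin k) ℝ) (m : ℕ) :
    ∀ e : Fin m → Fin k, Function.Injective e →
    ∫⁻ B, ENNReal.ofReal |((Matrix.of B + M).submatrix e e).det| ^ (-(3/4) : ℝ) ∂(cubeM k)
      ≤ KK ^ m := by
  induction m with
  | zero =>
    intro e _
    simp [cubeM]
  | succ m ih =>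
    intro e he
    have hs : Function.Injective (e ∘ Fin.succ) := he.comp (Fin.succ_injective m)
    rw [lintegral_resample2 k _ (det_meas k (m+1) M e) (e 0) (e 0), pow_succ']
    refine le_trans ?_ (mul_le_mul_right (ih _ hs) KK)
    rw [← lintegral_const_mul _ (det_meas k m M _)]
    refine lintegral_mono fun B => ?_
    set D := ((Matrix.of B + M).submatrix (e ∘ Fin.succ) (e ∘ Fin.succ)).det with hD
    set R := ∑ j : Fin m, (-1) ^ ((j.succ : Fin (m+1)) : ℕ) *
      ((Matrix.of B + M).submatrix e e) 0 j.succ *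
      (((Matrix.of B + M).submatrix e e).submatrix Fin.succ j.succ.succAbove).det with hR
    have key : ∀ t : ℝ, ((Matrix.of (Function.update B (e 0) (Function.update (B (e 0)) (e 0) t))
        + M).submatrix e e).det = t * D + (M (e 0) (e 0) * D + R) := by
      intro t
      have hrow : ∀ (i : Fin m), e i.succ ≠ e 0 := fun i h => Fin.succ_ne_zero i (he h)
      rw [Matrix.det_succ_row_zero, Fin.sum_univ_succ, ← add_assoc, ← add_mul]
      have hsub : ∀ g : Fin m → Fin (m+1),
          ((Matrix.of (Function.update B (e 0) (Function.update (B (e 0)) (e 0) t))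
        + M).submatrix e e).submatrix Fin.succ g
          = ((Matrix.of B + M).submatrix e e).submatrix Fin.succ g := by
        intro g
        ext i j
        simp [Function.update_of_ne (hrow i)]
      simp only [hsub]
      congr 1
      · simp [hD, Matrix.submatrix_submatrix, Fin.succAbove_zero]
      · refine Finset.sum_congr rfl fun j _ => ?_
        simp [Function.update_of_ne (hrow j)]
    simp_rw [key]
    exact one_dim D _

lemma cube_ae (k : ℕ) (A : ℕ → Matrix (Fin k) (Fin k) ℝ) :
    ∀ᵐ B ∂(cubeM k), ∃ ε : ℝ, 0 < ε ∧
        ∀ j : ℕ, ε * (((j : ℝ) + 1) ^ 2)⁻¹ ≤ |(Matrix.of B + A j).det| := by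
  have hmeas := fun j => det_meas k k (A j) id
  have hb := fun j => det_bound k (A j) k id Function.injective_id
  simp only [Matrix.submatrix_id_id] at hmeas hb
  set w : ℕ → ENNReal := fun j => ENNReal.ofReal (((j : ℝ) + 1) ^ 2) ^ (-(3/4) : ℝ) with hw
  have hwsum : ∑' j, w j ≠ ⊤ := by
    have hs : Summable (fun j : ℕ => ((j + 1 : ℕ) : ℝ) ^ (-(3/2) : ℝ)) :=
      (summable_nat_add_iff 1).2 (Real.summable_nat_rpow.2 (by norm_num))
    have : ∀ j, w j = ENNReal.ofReal (((j + 1 : ℕ) : ℝ) ^ (-(3/2) : ℝ)) := by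
      intro j
      simp only [hw]
      rw [ENNReal.ofReal_rpow_of_pos (by positivity), ← Real.rpow_natCast,
        ← Real.rpow_mul (by positivity)]
      norm_num
    simp_rw [this]
    exact hs.tsum_ofReal_ne_top
  have hint : ∫⁻ B, ∑' j, w j * ENNReal.ofReal |(Matrix.of B + A j).det| ^ (-(3/4) : ℝ) ∂(cubeM k)
      ≠ ⊤ := by
    rw [lintegral_tsum fun j => ((hmeas j).const_mul _).aemeasurable]
    refine ne_top_of_le_ne_top (b := ∑' j, w j * KK ^ k) ?_ ?_
    · rw [ENNReal.tsum_mul_right]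
      exact ENNReal.mul_ne_top hwsum (ENNReal.pow_ne_top KK_ne_top)
    · refine ENNReal.tsum_le_tsum fun j => ?_
      rw [lintegral_const_mul _ (hmeas j)]
      gcongr
      exact hb j
  have hfin := ae_lt_top (Measurable.tsum fun j => (hmeas j).const_mul (w j)) hint
  filter_upwards [hfin] with B hB
  set S := ∑' j, w j * ENNReal.ofReal |(Matrix.of B + A j).det| ^ (-(3/4) : ℝ) with hS
  have hT0 : S + 1 ≠ 0 := by simp
  have hT1 : S + 1 ≠ ⊤ := ENNReal.add_ne_top.2 ⟨hB.ne, ENNReal.one_ne_top⟩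
  set E : ENNReal := (S + 1)⁻¹ ^ ((4/3) : ℝ) with hE
  have hE0 : E ≠ 0 := by
    rw [hE, Ne, ENNReal.rpow_eq_zero_iff]
    simp [hT1, hT0]
  have hE1 : E ≠ ⊤ := ENNReal.rpow_ne_top_of_nonneg (by norm_num) (ENNReal.inv_ne_top.2 hT0)
  refine ⟨E.toReal, ENNReal.toReal_pos hE0 hE1, fun j => ?_⟩
  have h1 : w j * ENNReal.ofReal |(Matrix.of B + A j).det| ^ (-(3/4) : ℝ) ≤ S + 1 :=
    (ENNReal.le_tsum j).trans le_self_add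
  simp only [hw] at h1
  rw [← ENNReal.mul_rpow_of_ne_top ENNReal.ofReal_ne_top ENNReal.ofReal_ne_top,
    ← ENNReal.ofReal_mul (by positivity), ENNReal.rpow_neg, ENNReal.inv_le_iff_inv_le] at h1
  have h2 := ENNReal.rpow_le_rpow h1 (z := 4/3) (by norm_num)
  rw [← ENNReal.rpow_mul] at h2
  norm_num at h2
  rw [← div_eq_mul_inv, div_le_iff₀' (by positivity)]
  refine ENNReal.toReal_le_of_le_ofReal (by positivity) ?_
  rw [hE]
  convert h2 using 1

theorem stmt13 (k : ℕ) (A : ℕ → Matrix (Fin k) (Fin k) ℝ) :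
    ∀ᵐ B ∂(volume : Measure (Fin k → Fin k → ℝ)),
      ∃ ε : ℝ, 0 < ε ∧
        ∀ j : ℕ, ε * (((j : ℝ) + 1) ^ 2)⁻¹ ≤ |(Matrix.of B + A j).det| := by
  set C : Set (Fin k → Fin k → ℝ) :=
    Set.univ.pi fun _ => Set.univ.pi fun _ => Set.Icc (0:ℝ) 1 with hC
  have hCm : MeasurableSet C :=
    MeasurableSet.univ_pi fun _ => MeasurableSet.univ_pi fun _ => measurableSet_Icc
  have hcube : cubeM k = (volume : Measure (Fin k → Fin k → ℝ)).restrict C := by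
    rw [hC, volume_pi, Measure.restrict_pi_pi]
    unfold cubeM uni
    congr 1
    funext i
    rw [volume_pi, Measure.restrict_pi_pi]
  have main : ∀ N : Fin k → Fin k → ℤ, ∀ᵐ B ∂(volume : Measure (Fin k → Fin k → ℝ)),
      B - (fun i j => (N i j : ℝ)) ∈ C → ∃ ε : ℝ, 0 < ε ∧
        ∀ j : ℕ, ε * (((j : ℝ) + 1) ^ 2)⁻¹ ≤ |(Matrix.of B + A j).det| := by
    intro N
    set N' : Fin k → Fin k → ℝ := fun i j => (N i j : ℝ) with hN'
    have h := cube_ae k (fun j => Matrix.of N' + A j)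
    rw [hcube, ae_restrict_iff' hCm] at h
    have h2 := (measurePreserving_sub_right (volume : Measure (Fin k → Fin k → ℝ)) N'
      ).quasiMeasurePreserving.ae h
    filter_upwards [h2] with B hB hBC
    have := hB hBC
    have e : ∀ j, Matrix.of (B - N') + (Matrix.of N' + A j) = Matrix.of B + A j := by
      intro j
      ext a b
      simp
      ring
    simpa only [e] using this
  filter_upwards [ae_all_iff.2 main] with B hB
  refine hB (fun i j => ⌊B i j⌋) ?_
  intro i _ j _
  exact ⟨Int.fract_nonneg (B i j), (Int.fract_lt_one (B i j)).le⟩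
end

section
/- Fix k ≥ 1. There exists a constant c > 0 depending only on k such that for every matrix Ã ∈ ℝ^{k×k} and every η > 0, the Lebesgue measure of the set { A ∈ B(0,1)ᵏ : |det(A + Ã)| ≤ η } is at most c·η, where B(0,1)ᵏ denotes the set of matrices whose columns each lie in the Euclidean unit ball of ℝᵏ. -/
open MeasureTheory

lemma det_schur {n : ℕ} (N : Matrix (Fin (n+1)) (Fin (n+1)) ℝ) (i : Fin (n+1)) (hp : N 0 i ≠ 0) :
    |N.det| = |N 0 i| * |(Matrix.of fun j l : Fin n =>
      N j.succ (i.succAbove l) - N j.succ i * N 0 (i.succAbove l) / N 0 i).det| := by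
  have h1 : N.det = (Matrix.of fun j l => N j l - (if j = 0 then 0 else N j i / N 0 i) * N 0 l).det := by
    refine (Matrix.det_eq_of_forall_row_eq_smul_add_const
      (fun j => if j = 0 then 0 else N j i / N 0 i) 0 (by simp) ?_)
    intro a b; simp
  rw [h1, Matrix.det_succ_column _ i, Fin.sum_univ_succ, Finset.sum_eq_zero]
  · simp only [Matrix.of_apply, add_zero, abs_mul, abs_pow, abs_neg, abs_one, one_pow, one_mul,
      if_true, zero_mul, sub_zero]
    congr 2
    congr 1
    ext j l
    simp [Fin.succ_ne_zero]
    ring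
  · intro j _
    simp [Fin.succ_ne_zero, hp]

lemma lint_inv (n : ℕ) : ∃ K : ENNReal, K ≠ ⊤ ∧ ∀ m : Fin (n+2) → ℝ,
    ∫⁻ x in {x : Fin (n+2) → ℝ | ∀ i, |x i| ≤ 1}, ‖x + m‖ₑ⁻¹ ≤ K := by
  have hI : IntegrableOn (fun x : Fin (n+2) → ℝ => ‖x‖⁻¹) (Metric.ball 0 1) := by
    rw [integrableOn_fun_norm_addHaar volume (f := fun r => r⁻¹)]
    have : IntegrableOn (fun y : ℝ => y ^ n) (Set.Ioo 0 1) :=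
      ((continuous_pow n).integrableOn_Icc (a := 0) (b := 1)).mono_set Set.Ioo_subset_Icc_self
    refine this.congr_fun ?_ measurableSet_Ioo
    intro y hy
    have := hy.1.ne'
    simp [pow_succ]
    field_simp
  have hfin : ∫⁻ x in Metric.ball (0 : Fin (n+2) → ℝ) 1, ‖x‖ₑ⁻¹ ≠ ⊤ := by
    have := hI.2
    rw [hasFiniteIntegral_iff_enorm] at this
    refine ne_of_lt (lt_of_le_of_lt (le_of_eq ?_) this)
    refine lintegral_congr_ae (ae_restrict_of_ae ?_)
    filter_upwards [(measure_eq_zero_iff_ae_notMem (μ := volume)).1 (measure_singleton (0 : Fin (n+2) → ℝ))] with x hx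
    rw [enorm_inv (by simpa using hx), enorm_norm]
  have hcube : volume {x : Fin (n+2) → ℝ | ∀ i, |x i| ≤ 1} ≠ ⊤ := by
    refine ne_top_of_le_ne_top (measure_closedBall_lt_top (x := (0 : Fin (n+2) → ℝ)) (r := 1)).ne (measure_mono ?_)
    intro x hx
    rw [mem_closedBall_zero_iff, pi_norm_le_iff_of_nonneg zero_le_one]
    exact hx
  refine ⟨_, ENNReal.add_ne_top.2 ⟨hcube, hfin⟩, fun m => ?_⟩
  calc _ ≤ ∫⁻ x in {x : Fin (n+2) → ℝ | ∀ i, |x i| ≤ 1}, (1 + (Metric.ball 0 1).indicator (fun y => ‖y‖ₑ⁻¹) (x + m)) := by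
        refine lintegral_mono fun x => ?_
        by_cases h : x + m ∈ Metric.ball 0 1
        · rw [Set.indicator_of_mem h]; exact le_add_self
        · refine le_add_right ?_
          rw [mem_ball_zero_iff, not_lt] at h
          rw [ENNReal.inv_le_one, ← ofReal_norm]
          exact ENNReal.one_le_ofReal.2 h
    _ = volume {x : Fin (n+2) → ℝ | ∀ i, |x i| ≤ 1} + ∫⁻ x in {x : Fin (n+2) → ℝ | ∀ i, |x i| ≤ 1}, ((Metric.ball 0 1).indicator (fun y => ‖y‖ₑ⁻¹) (x + m)) := by
        rw [lintegral_add_left measurable_const]; simp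
    _ ≤ _ := by
        refine add_le_add le_rfl ?_
        refine (setLIntegral_le_lintegral _ _).trans ?_
        rw [lintegral_add_right_eq_self (μ := volume) (fun x => (Metric.ball 0 1).indicator (fun y => ‖y‖ₑ⁻¹) x) m,
          lintegral_indicator measurableSet_ball]

def Q (n : ℕ) : Prop := ∃ C : ENNReal, C ≠ 0 ∧ C ≠ ⊤ ∧ ∀ (M : Fin n → Fin n → ℝ) (η : ℝ), 0 < η →
  volume {A : Fin n → Fin n → ℝ | (∀ i j, |A i j| ≤ 1) ∧ |(Matrix.of (A + M)).det| ≤ η} ≤ C * ENNReal.ofReal η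

lemma Q_one : Q 1 := by
  refine ⟨2, by simp, by simp, fun M η hη => ?_⟩
  have h := (volume_preserving_funUnique (Fin 1) ℝ).comp (volume_preserving_funUnique (Fin 1) (Fin 1 → ℝ))
  calc _ ≤ volume ((fun A : Fin 1 → Fin 1 → ℝ => A 0 0) ⁻¹' (Metric.closedBall (- M 0 0) η)) := by
        refine measure_mono ?_
        rintro A ⟨_, hA⟩
        simpa [Real.dist_eq] using hA
    _ = volume (Metric.closedBall (- M 0 0) η) :=
        h.measure_preimage measurableSet_closedBall.nullMeasurableSet
    _ = _ := by rw [Real.volume_closedBall, ENNReal.ofReal_mul (by norm_num)]; simp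

lemma inner_bound {n : ℕ} {C : ENNReal}
    (hC : ∀ (M : Fin n → Fin n → ℝ) (η : ℝ), 0 < η →
  volume {A : Fin n → Fin n → ℝ | (∀ i j, |A i j| ≤ 1) ∧ |(Matrix.of (A + M)).det| ≤ η} ≤ C * ENNReal.ofReal η)
  (M : Fin (n+1) → Fin (n+1) → ℝ) (η : ℝ) (hη : 0 < η) (x : Fin (n+1) → ℝ) (i : Fin (n+1)) (hx : x i + M 0 i ≠ 0) :
  volume {B : Fin n → Fin (n+1) → ℝ | (∀ i j, |B i j| ≤ 1) ∧
     |(Matrix.of ((Fin.cons x B : Fin (n+1) → Fin (n+1) → ℝ) + M)).det| ≤ η} ≤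
     2 ^ n * (C * ENNReal.ofReal (η / |x i + M 0 i|)) := by
  have hmp := (volume_measurePreserving_arrowProdEquivProdArrow ℝ (Fin n → ℝ) (Fin n)).comp
    (volume_preserving_pi (fun _ : Fin n => volume_preserving_piFinSuccAbove (fun _ : Fin (n+1) => ℝ) i))
  set p := x i + M 0 i with hp
  set T : Set ((Fin n → ℝ) × (Fin n → Fin n → ℝ)) := {z | (∀ j, |z.1 j| ≤ 1) ∧ (∀ j l, |z.2 j l| ≤ 1) ∧
    |(Matrix.of (z.2 + fun j l => M j.succ (i.succAbove l) - (z.1 j + M j.succ i) * (x (i.succAbove l) + M 0 (i.succAbove l)) / p)).det| ≤ η / |p|} with hT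
  have hTm : MeasurableSet T := by
    refine IsClosed.measurableSet ?_
    simp only [hT, Set.ofPred_and, Set.ofPred_forall]
    refine IsClosed.inter (isClosed_iInter fun j => isClosed_le (by fun_prop) (by fun_prop)) (IsClosed.inter
      (isClosed_iInter fun j => isClosed_iInter fun l => isClosed_le (by fun_prop) (by fun_prop)) (isClosed_le ?_ continuous_const))
    refine (Continuous.matrix_det ?_).abs
    refine continuous_matrix fun a b => ?_
    simp only [Matrix.of_apply, Pi.add_apply]
    fun_prop
  calc _ ≤ volume (((MeasurableEquiv.arrowProdEquivProdArrow ℝ (Fin n → ℝ) (Fin n)) ∘ fun (B : Fin n → Fin (n+1) → ℝ) j =>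
      MeasurableEquiv.piFinSuccAbove (fun _ : Fin (n+1) => ℝ) i (B j)) ⁻¹' T) := by
        refine measure_mono ?_
        rintro B ⟨hB, hd⟩
        refine ⟨fun j => hB j i, fun j l => hB j _, ?_⟩
        rw [det_schur _ i (by simpa using hx)] at hd
        rw [le_div_iff₀ (abs_pos.2 hx), mul_comm]
        refine le_trans (le_of_eq ?_) hd
        simp only [Matrix.of_apply, Pi.add_apply, Fin.cons_zero, Fin.cons_succ, ← hp]
        congr 2
        congr 1
        ext j l
        simp [MeasurableEquiv.arrowProdEquivProdArrow, Equiv.arrowProdEquivProdArrow, Fin.removeNth]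
        ring
    _ = volume T := hmp.measure_preimage hTm.nullMeasurableSet
    _ = ∫⁻ r, volume (Prod.mk r ⁻¹' T) := by
        rw [Measure.volume_eq_prod, Measure.prod_apply hTm]
    _ ≤ ∫⁻ r, (Metric.closedBall (0 : Fin n → ℝ) 1).indicator (fun _ => C * ENNReal.ofReal (η / |p|)) r := by
        refine lintegral_mono fun r => ?_
        by_cases hr : r ∈ Metric.closedBall (0 : Fin n → ℝ) 1
        · rw [Set.indicator_of_mem hr]
          refine le_trans (measure_mono ?_) (hC (fun j l => M j.succ (i.succAbove l) - (r j + M j.succ i) * (x (i.succAbove l) + M 0 (i.succAbove l)) / p) (η / |p|) (div_pos hη (abs_pos.2 hx)))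
          rintro B ⟨_, h2, h3⟩
          exact ⟨h2, h3⟩
        · rw [Set.indicator_of_notMem hr]
          refine le_of_eq ?_
          convert measure_empty
          · ext B
            simp only [Set.mem_preimage, Set.mem_empty_iff_false, iff_false]
            rintro ⟨h1, -⟩
            apply hr
            rw [mem_closedBall_zero_iff, pi_norm_le_iff_of_nonneg zero_le_one]
            exact h1
          · infer_instance
    _ = _ := by
        rw [lintegral_indicator measurableSet_closedBall, lintegral_const, Measure.restrict_apply_univ, Real.volume_pi_closedBall _ zero_le_one, mul_comm]
        simp

lemma Q_step (n : ℕ) (h : Q (n+1)) : Q (n+2) := by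
  obtain ⟨C, hC0, hCt, hC⟩ := h
  obtain ⟨K, hK, hKb⟩ := lint_inv n
  refine ⟨2 ^ (n+1) * C * (K + 1), ?_, ?_, fun M η hη => ?_⟩
  · simp [hC0]
  · finiteness
  have hmp := volume_preserving_piFinSuccAbove (fun _ : Fin (n+2) => (Fin (n+2) → ℝ)) 0
  set T : Set ((Fin (n+2) → ℝ) × (Fin (n+1) → Fin (n+2) → ℝ)) := {z | (∀ j, |z.1 j| ≤ 1) ∧ (∀ j l, |z.2 j l| ≤ 1) ∧
    |(Matrix.of ((Fin.cons z.1 z.2 : Fin (n+2) → Fin (n+2) → ℝ) + M)).det| ≤ η} with hT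
  have hTm : MeasurableSet T := by
    refine IsClosed.measurableSet ?_
    simp only [hT, Set.ofPred_and, Set.ofPred_forall]
    refine IsClosed.inter (isClosed_iInter fun j => isClosed_le (by fun_prop) (by fun_prop)) (IsClosed.inter
      (isClosed_iInter fun j => isClosed_iInter fun l => isClosed_le (by fun_prop) (by fun_prop)) (isClosed_le ?_ continuous_const))
    refine (Continuous.matrix_det ?_).abs
    refine continuous_matrix fun a b => ?_
    simp only [Matrix.of_apply, Pi.add_apply]
    refine Fin.cases ?_ (fun a => ?_) a
    · simp only [Fin.cons_zero]; fun_prop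
    · simp only [Fin.cons_succ]; fun_prop
  calc _ ≤ volume ((MeasurableEquiv.piFinSuccAbove (fun _ : Fin (n+2) => (Fin (n+2) → ℝ)) 0) ⁻¹' T) := by
        refine measure_mono ?_
        rintro A ⟨hA, hd⟩
        refine ⟨fun j => hA 0 j, fun j l => hA _ l, ?_⟩
        convert hd using 5
        exact Fin.cons_self_tail A
    _ = volume T := hmp.measure_preimage hTm.nullMeasurableSet
    _ = ∫⁻ r, volume (Prod.mk r ⁻¹' T) := by
        rw [Measure.volume_eq_prod, Measure.prod_apply hTm]
    _ ≤ ∫⁻ r, ({x : Fin (n+2) → ℝ | ∀ i, |x i| ≤ 1}).indicator (fun x => 2 ^ (n+1) * C * ENNReal.ofReal η * ‖x + M 0‖ₑ⁻¹) r := by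
        refine lintegral_mono fun r => ?_
        by_cases hr : r ∈ {x : Fin (n+2) → ℝ | ∀ i, |x i| ≤ 1}
        · rw [Set.indicator_of_mem hr]
          by_cases hz : r + M 0 = 0
          · rw [hz]; simp [ENNReal.mul_top, hC0, hη]
          obtain ⟨i, hi⟩ : ∃ i, ‖(r + M 0) i‖ = ‖r + M 0‖ := by
            obtain ⟨i, -, hi⟩ := Finset.exists_mem_eq_sup' (Finset.univ_nonempty) (fun i => ‖(r + M 0) i‖₊)
            refine ⟨i, ?_⟩
            rw [Pi.norm_def, ← coe_nnnorm, ← hi, Finset.sup'_eq_sup]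
          have hne : r i + M 0 i ≠ 0 := by
            rw [← ne_eq, ← norm_ne_zero_iff] at hz
            rw [← norm_ne_zero_iff]
            rw [← hi] at hz; exact hz
          refine le_trans (measure_mono ?_) ((inner_bound hC M η hη r i hne).trans (le_of_eq ?_))
          · rintro B ⟨_, h2, h3⟩
            exact ⟨h2, h3⟩
          · rw [← ofReal_norm, ← hi, ENNReal.ofReal_div_of_pos (abs_pos.2 hne), div_eq_mul_inv]
            simp only [Real.norm_eq_abs, Pi.add_apply]
            ring
        · rw [Set.indicator_of_notMem hr]
          refine le_of_eq ?_
          convert measure_empty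
          · ext B
            simp only [Set.mem_preimage, Set.mem_empty_iff_false, iff_false]
            rintro ⟨h1, -⟩
            exact hr h1
          · infer_instance
    _ ≤ _ := by
        rw [lintegral_indicator, lintegral_const_mul']
        · calc _ ≤ 2 ^ (n+1) * C * ENNReal.ofReal η * K := by gcongr; exact hKb _
            _ ≤ 2 ^ (n+1) * C * ENNReal.ofReal η * (K + 1) := by gcongr; exact le_self_add
            _ = _ := by ring
        · finiteness
        · simp only [Set.ofPred_forall]
          exact (isClosed_iInter fun j => isClosed_le (by fun_prop) (by fun_prop)).measurableSet

lemma Q_all (n : ℕ) : Q (n+1) := by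
  induction n with
  | zero => exact Q_one
  | succ n ih => exact Q_step n ih

theorem stmt14 (k : ℕ) (hk : 0 < k) :
    ∃ c : ℝ, 0 < c ∧
      ∀ (Atilde : Fin k → EuclideanSpace ℝ (Fin k)) (η : ℝ), 0 < η →
        (volume {A : Fin k → EuclideanSpace ℝ (Fin k) |
            (∀ i, ‖A i‖ ≤ 1) ∧
            |(Matrix.of (fun i j : Fin k => A j i) +
              Matrix.of (fun i j : Fin k => Atilde j i)).det| ≤ η})
          ≤ ENNReal.ofReal (c * η) := by
  obtain ⟨n, rfl⟩ : ∃ n, k = n + 1 := ⟨k - 1, by omega⟩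
  obtain ⟨C, hC0, hCt, hC⟩ := Q_all n
  refine ⟨C.toReal, ENNReal.toReal_pos hC0 hCt, fun M η hη => ?_⟩
  rw [ENNReal.ofReal_mul ENNReal.toReal_nonneg, ENNReal.ofReal_toReal hCt]
  have hmp := volume_preserving_pi (fun _ : Fin (n+1) => PiLp.volume_preserving_ofLp (Fin (n+1)))
  refine le_trans ?_ (hC (fun j i => M j i) η hη)
  rw [← hmp.measure_preimage]
  · refine measure_mono ?_
    rintro A ⟨hA, hd⟩
    refine ⟨fun i j => (PiLp.norm_apply_le (A i) j).trans (hA i), ?_⟩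
    rw [← Matrix.det_transpose]
    exact hd
  · refine (IsClosed.measurableSet ?_).nullMeasurableSet
    simp only [Set.ofPred_and, Set.ofPred_forall]
    refine IsClosed.inter
      (isClosed_iInter fun j => isClosed_iInter fun l => isClosed_le (by fun_prop) (by fun_prop)) (isClosed_le ?_ continuous_const)
    refine (Continuous.matrix_det ?_).abs
    refine continuous_matrix fun a b => ?_
    simp only [Matrix.of_apply, Pi.add_apply]
    fun_prop
end
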